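/- arXiv:2403.07000 — 5 statements merged into one kernel-verified Lean document; each statement's English description precedes it below -/
import Mathlib

section
/- Let α, β be real numbers with 0 < α and α² < β, and let F : ℝ⁴ → ℝ⁴ be the Hamiltonian vector field of the dimensionless double pendulum. Then F(θ1, θ2, p1, p2) = 0 if and only if p1 = 0, p2 = 0, sin θ1 = 0 and sin θ2 = 0. -/
open Matrix

/-- The mass matrix of the dimensionless double pendulum. -/
noncomputable def dpB (α β x : ℝ) : Matrix (Fin 2) (Fin 2) ℝ := !![β, α * x; α * x, 1]

/-- The matrix C(x), the derivative of x ↦ B(x)⁻¹. -/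
noncomputable def dpC (α β x : ℝ) : Matrix (Fin 2) (Fin 2) ℝ :=
  -(α / (β - α ^ 2 * x ^ 2) ^ 2) •
    !![-(2 * α * x), β + α ^ 2 * x ^ 2; β + α ^ 2 * x ^ 2, -(2 * α * β * x)]

/-- The Hamiltonian vector field of the dimensionless double pendulum, with components
(θ1′, θ2′, p1′, p2′). -/
noncomputable def dpF (α β θ1 θ2 p1 p2 : ℝ) : ℝ × ℝ × ℝ × ℝ :=
  ((dpB α β (Real.cos (θ1 - θ2)))⁻¹.mulVec ![p1, p2] 0,
   (dpB α β (Real.cos (θ1 - θ2)))⁻¹.mulVec ![p1, p2] 1,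
   Real.sin (θ1 - θ2) / 2 *
     (![p1, p2] ⬝ᵥ (dpC α β (Real.cos (θ1 - θ2))).mulVec ![p1, p2]) * 1
     - β / α * Real.sin θ1,
   Real.sin (θ1 - θ2) / 2 *
     (![p1, p2] ⬝ᵥ (dpC α β (Real.cos (θ1 - θ2))).mulVec ![p1, p2]) * (-1)
     - Real.sin θ2)

theorem dpB_det_pos {α β : ℝ} (hβ : α ^ 2 < β) {x : ℝ} (hx : x ^ 2 ≤ 1) :
    0 < (dpB α β x).det := by
  rw [dpB, Matrix.det_fin_two_of]
  nlinarith [mul_le_mul_of_nonneg_left hx (sq_nonneg α)]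

theorem dpB_inv_mulVec_eq_zero_iff {α β : ℝ} (hβ : α ^ 2 < β) {x : ℝ} (hx : x ^ 2 ≤ 1)
    (v : Fin 2 → ℝ) : (dpB α β x)⁻¹.mulVec v = 0 ↔ v = 0 := by
  have hdet : IsUnit (dpB α β x).det := (dpB_det_pos hβ hx).ne'.isUnit
  refine ⟨fun h => ?_, fun h => by rw [h, Matrix.mulVec_zero]⟩
  rw [← Matrix.one_mulVec v, ← Matrix.mul_nonsing_inv _ hdet, ← Matrix.mulVec_mulVec, h,
    Matrix.mulVec_zero]

theorem double_pendulum_equilibria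
    (α β : ℝ) (hα : 0 < α) (hβ : α ^ 2 < β) (θ1 θ2 p1 p2 : ℝ) :
    dpF α β θ1 θ2 p1 p2 = 0 ↔
      p1 = 0 ∧ p2 = 0 ∧ Real.sin θ1 = 0 ∧ Real.sin θ2 = 0 := by
  have hv : ![p1, p2] = 0 ↔ p1 = 0 ∧ p2 = 0 := by simp
  have hB := dpB_inv_mulVec_eq_zero_iff hβ (Real.cos_sq_le_one (θ1 - θ2)) ![p1, p2]
  have hβα : β / α ≠ 0 := (div_pos ((sq_nonneg α).trans_lt hβ) hα).ne'
  simp only [dpF, Prod.mk_eq_zero]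
  constructor
  · rintro ⟨h1, h2, h3, h4⟩
    have hp : ![p1, p2] = 0 := hB.1 (funext (Fin.forall_fin_two.2 ⟨h1, h2⟩))
    obtain ⟨hp1, hp2⟩ := hv.1 hp
    rw [hp, zero_dotProduct, mul_zero, zero_mul, zero_sub, neg_eq_zero] at h3 h4
    exact ⟨hp1, hp2, (mul_eq_zero.1 h3).resolve_left hβα, h4⟩
  · rintro ⟨hp1, hp2, h1, h2⟩
    rw [hv.2 ⟨hp1, hp2⟩, h1, h2]
    simp
end

section
/- Let α, β be real numbers with 0 < α and α² < β, and set γ = β − α². Let J1 be the 4×4 real matrix (1/γ)·[[0, 0, 1, −α], [0, 0, −α, β], [−βγ/α, 0, 0, 0], [0, −γ, 0, 0]] (the Jacobian of the double-pendulum vector field at the equilibrium (0, 0, 0, 0)). Then the characteristic polynomial of J1 is λ⁴ + (β(1+α)/(αγ))·λ² + β/(αγ), and every complex eigenvalue λ of J1 is nonzero and purely imaginary (Re λ = 0). Hence the equilibrium (0,0,0,0) has center×center linear stability. -/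
open Matrix Polynomial

theorem charpoly_antidiagonal_block {R : Type*} [CommRing R] (a b c d e f : R) :
    (!![0, 0, a, b; 0, 0, c, d; e, 0, 0, 0; 0, f, 0, 0] : Matrix (Fin 4) (Fin 4) R).charpoly =
      X ^ 4 - C (a * e + d * f) * X ^ 2 + C (e * f * (a * d - b * c)) := by
  simp [Matrix.charpoly, Matrix.charmatrix_apply, Matrix.det_succ_row_zero, Fin.sum_univ_succ,
    Fin.succAbove, Matrix.diagonal_apply]
  ring

theorem Complex.re_eq_zero_of_sq_eq_neg {μ : ℂ} {r : ℝ} (hr : r < 0) (h : μ ^ 2 = r) :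
    μ.re = 0 := by
  have hre := congrArg Complex.re h
  have him := congrArg Complex.im h
  simp only [sq, Complex.mul_re, Complex.mul_im, Complex.ofReal_re, Complex.ofReal_im] at hre him
  have hxy : μ.re * μ.im = 0 := by linarith
  rcases mul_eq_zero.mp hxy with hx | hy
  · exact hx
  · rw [hy] at hre
    nlinarith [mul_self_nonneg μ.re]

theorem Complex.ne_zero_and_re_eq_zero_of_biquadratic {b c : ℝ} (hb : 0 < b) (hc : 0 < c)
    (hD : 4 * c ≤ b ^ 2) {μ : ℂ} (h : μ ^ 4 + b * μ ^ 2 + c = 0) : μ ≠ 0 ∧ μ.re = 0 := by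
  refine ⟨?_, ?_⟩
  · rintro rfl
    simp [hc.ne'] at h
  · set s := √(b ^ 2 - 4 * c)
    have hs : s ^ 2 = b ^ 2 - 4 * c := Real.sq_sqrt (by linarith)
    have hs₀ : 0 ≤ s := Real.sqrt_nonneg _
    have hsb : s < b := by nlinarith
    have hsC : (s : ℂ) ^ 2 = (b : ℂ) ^ 2 - 4 * c := by exact_mod_cast hs
    have hfac : (μ ^ 2 - ((-b + s) / 2 : ℝ)) * (μ ^ 2 - ((-b - s) / 2 : ℝ)) = 0 := by
      push_cast
      linear_combination h - hsC / 4
    rcases mul_eq_zero.mp hfac with h₁ | h₁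
    · exact Complex.re_eq_zero_of_sq_eq_neg (by linarith) (sub_eq_zero.mp h₁)
    · exact Complex.re_eq_zero_of_sq_eq_neg (by linarith) (sub_eq_zero.mp h₁)

theorem double_pendulum_center_center_equilibrium
    (α β : ℝ) (hα : 0 < α) (hβ : α ^ 2 < β)
    (γ : ℝ) (hγ : γ = β - α ^ 2)
    (J1 : Matrix (Fin 4) (Fin 4) ℝ)
    (hJ1 : J1 = (1 / γ) •
      !![0, 0, 1, -α;
         0, 0, -α, β;
         -(β * γ / α), 0, 0, 0;
         0, -γ, 0, 0]) :
    J1.charpoly = X ^ 4 + C (β * (1 + α) / (α * γ)) * X ^ 2 + C (β / (α * γ)) ∧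
    ∀ μ : ℂ, ((J1.map (algebraMap ℝ ℂ)).charpoly).IsRoot μ → μ ≠ 0 ∧ μ.re = 0 := by
  have hγ₀ : 0 < γ := by linarith
  have hβ₀ : 0 < β := (sq_nonneg α).trans_lt hβ
  have hchar : J1.charpoly =
      X ^ 4 + C (β * (1 + α) / (α * γ)) * X ^ 2 + C (β / (α * γ)) := by
    have hJ : J1 = !![0, 0, 1 / γ, -α / γ; 0, 0, -α / γ, β / γ; -(β / α), 0, 0, 0;
        0, -1, 0, 0] := by
      rw [hJ1]
      ext i j
      fin_cases i <;> fin_cases j <;> simp <;> field_simp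
    have htr : 1 / γ * -(β / α) + β / γ * -1 = -(β * (1 + α) / (α * γ)) := by
      field_simp
      ring
    have hdet : -(β / α) * -1 * (1 / γ * (β / γ) - -α / γ * (-α / γ)) = β / (α * γ) := by
      field_simp
      exact hγ.symm
    rw [hJ, charpoly_antidiagonal_block, htr, hdet, C_neg, neg_mul, sub_neg_eq_add]
  refine ⟨hchar, fun μ hμ => ?_⟩
  rw [Matrix.charpoly_map, hchar] at hμ
  refine Complex.ne_zero_and_re_eq_zero_of_biquadratic (b := β * (1 + α) / (α * γ))
    (c := β / (α * γ)) (by positivity) (by positivity) ?_ (by simpa [IsRoot] using hμ)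
  have hle : 4 * (α * γ) ≤ β * (1 + α) ^ 2 := by
    nlinarith [mul_nonneg hβ₀.le (sq_nonneg (1 - α)), pow_pos hα 3]
  rw [div_pow, mul_div_assoc', div_le_div_iff₀ (by positivity) (by positivity)]
  nlinarith [mul_le_mul_of_nonneg_left hle (by positivity : 0 ≤ β * (α * γ))]
end

section
/- Let α, β be real numbers with 0 < α and α² < β, and set γ = β − α². Let J2 be the 4×4 real matrix (1/γ)·[[0, 0, 1, α], [0, 0, α, β], [−βγ/α, 0, 0, 0], [0, γ, 0, 0]] (the Jacobian of the double-pendulum vector field at the equilibrium (0, π, 0, 0)). Then J2 has exactly one positive real eigenvalue r > 0 and one negative real eigenvalue −r, and its other two eigenvalues are a conjugate pair of nonzero purely imaginary numbers ±i·s with s > 0. Hence (0, π, 0, 0) is an index-1 saddle with saddle×center linear stability. -/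
open Matrix Polynomial

/-- Two reals with negative product `-c` and sum `b` can be written as `r ^ 2` and `-s ^ 2`. -/
theorem exists_pos_sq_sub_sq_eq_and_sq_mul_sq_eq (b : ℝ) {c : ℝ} (hc : 0 < c) :
    ∃ r s : ℝ, 0 < r ∧ 0 < s ∧ r ^ 2 - s ^ 2 = b ∧ r ^ 2 * s ^ 2 = c := by
  have hD : √(b ^ 2 + 4 * c) ^ 2 = b ^ 2 + 4 * c := Real.sq_sqrt (by positivity)
  have hlt : |b| < √(b ^ 2 + 4 * c) := by
    rw [← Real.sqrt_sq_eq_abs]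
    exact Real.sqrt_lt_sqrt (sq_nonneg b) (by linarith)
  obtain ⟨hneg, hpos⟩ := abs_lt.mp hlt
  have hr : 0 < (√(b ^ 2 + 4 * c) + b) / 2 := by linarith
  have hs : 0 < (√(b ^ 2 + 4 * c) - b) / 2 := by linarith
  refine ⟨√((√(b ^ 2 + 4 * c) + b) / 2), √((√(b ^ 2 + 4 * c) - b) / 2),
    Real.sqrt_pos.mpr hr, Real.sqrt_pos.mpr hs, ?_, ?_⟩
  · rw [Real.sq_sqrt hr.le, Real.sq_sqrt hs.le]
    ring
  · rw [Real.sq_sqrt hr.le, Real.sq_sqrt hs.le]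
    linear_combination hD / 4

theorem roots_X_pow_four_sub_sub (r s : ℂ) :
    (X ^ 4 - C (r ^ 2 - s ^ 2) * X ^ 2 - C (r ^ 2 * s ^ 2) : ℂ[X]).roots =
      {r, -r, s * Complex.I, -(s * Complex.I)} := by
  have hfactor : (X ^ 4 - C (r ^ 2 - s ^ 2) * X ^ 2 - C (r ^ 2 * s ^ 2) : ℂ[X]) =
      (({r, -r, s * Complex.I, -(s * Complex.I)} : Multiset ℂ).map fun a => X - C a).prod := by
    have hI : (C Complex.I : ℂ[X]) ^ 2 = -1 := by
      rw [← C_pow, Complex.I_sq, C_neg, C_1]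
    simp only [Multiset.insert_eq_cons, Multiset.map_cons, Multiset.map_singleton,
      Multiset.prod_cons, Multiset.prod_singleton, C_neg, C_mul, C_sub, C_pow]
    linear_combination (C s ^ 2 * (X ^ 2 - C r ^ 2)) * hI
  rw [hfactor, roots_multiset_prod_X_sub_C]

/-- The characteristic polynomial of a matrix of the shape taken by the linearization of a
two-degree-of-freedom mechanical system with diagonal Hessian of the potential. -/
theorem charpoly_offDiag_blocks {R : Type*} [CommRing R] [IsDomain R] [Infinite R]
    (a b d e f : R) :
    (!![0, 0, a, b; 0, 0, b, d; e, 0, 0, 0; 0, f, 0, 0] : Matrix (Fin 4) (Fin 4) R).charpoly =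
      X ^ 4 - C (a * e + d * f) * X ^ 2 - C ((b ^ 2 - a * d) * e * f) := by
  refine Polynomial.funext fun x => ?_
  rw [eval_charpoly]
  simp [det_succ_row_zero, Fin.sum_univ_succ, Fin.succAbove, Matrix.scalar_apply,
    Matrix.diagonal_apply]
  ring

theorem double_pendulum_saddle_center_equilibrium_zero_pi
    (α β : ℝ) (hα : 0 < α) (hβ : α ^ 2 < β)
    (γ : ℝ) (hγ : γ = β - α ^ 2)
    (J2 : Matrix (Fin 4) (Fin 4) ℝ)
    (hJ2 : J2 = (1 / γ) •
      !![0, 0, 1, α;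
         0, 0, α, β;
         -(β * γ / α), 0, 0, 0;
         0, γ, 0, 0]) :
    ∃ r s : ℝ, 0 < r ∧ 0 < s ∧
      ((J2.map (algebraMap ℝ ℂ)).charpoly).roots =
        {(r : ℂ), -(r : ℂ), (s : ℂ) * Complex.I, -((s : ℂ) * Complex.I)} := by
  have hγ0 : 0 < γ := by linarith
  have hβ0 : 0 < β := (sq_nonneg α).trans_lt hβ
  obtain ⟨r, s, hr, hs, hsub, hmul⟩ := exists_pos_sq_sub_sq_eq_and_sq_mul_sq_eq
    ((β - β / α) / γ) (c := β / (α * γ)) (by positivity)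
  refine ⟨r, s, hr, hs, ?_⟩
  have hJ : J2 = !![0, 0, 1 / γ, α / γ; 0, 0, α / γ, β / γ; -(β / α), 0, 0, 0; 0, 1, 0, 0] := by
    rw [hJ2]
    ext i j
    fin_cases i <;> fin_cases j <;> simp <;> field_simp
  have hchar : J2.charpoly = X ^ 4 - C (r ^ 2 - s ^ 2) * X ^ 2 - C (r ^ 2 * s ^ 2) := by
    rw [hJ, charpoly_offDiag_blocks, hsub, hmul]
    congr 2
    · congr 2
      field_simp
      ring
    · field_simp
      rw [hγ]
      ring
  rw [charpoly_map, hchar, ← roots_X_pow_four_sub_sub]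
  simp
end

section
/- Let α, β be real numbers with 0 < α and α² < β, and set γ = β − α². Let J4 be the 4×4 real matrix (1/γ)·[[0, 0, 1, −α], [0, 0, −α, β], [βγ/α, 0, 0, 0], [0, γ, 0, 0]] (the Jacobian of the double-pendulum vector field at the equilibrium (π, π, 0, 0)). Then the characteristic polynomial of J4 is λ⁴ − (β(1+α)/(αγ))·λ² + β/(αγ), and J4 has four distinct nonzero real eigenvalues, occurring in pairs ±λ1, ±λ2 with λ1 > λ2 > 0. Hence (π, π, 0, 0) is an index-2 saddle with saddle×saddle linear stability. -/
open Matrix Polynomial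

theorem charpoly_offDiagonal_blocks {R : Type*} [CommRing R] (p q r s t : R) :
    (!![0, 0, p, q; 0, 0, q, r; s, 0, 0, 0; 0, t, 0, 0] : Matrix (Fin 4) (Fin 4) R).charpoly =
      X ^ 4 - C (p * s + r * t) * X ^ 2 + C ((p * r - q ^ 2) * (s * t)) := by
  have h : (!![0, 0, p, q; 0, 0, q, r; s, 0, 0, 0; 0, t, 0, 0] :
      Matrix (Fin 4) (Fin 4) R).charmatrix =
      !![X, 0, -C p, -C q; 0, X, -C q, -C r; -C s, 0, X, 0; 0, -C t, 0, X] := by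
    ext1 i j
    fin_cases i <;> fin_cases j <;> simp
  rw [Matrix.charpoly, h]
  simp [det_succ_row_zero, Fin.sum_univ_succ, Fin.succAbove]
  ring

theorem biquadratic_roots {a b : ℝ} (ha : 0 < a) (hb : 0 < b) (hab : 4 * b < a ^ 2) :
    ∃ x y : ℝ, x > y ∧ y > 0 ∧
      (X ^ 4 - C a * X ^ 2 + C b : ℝ[X]).roots = {x, -x, y, -y} := by
  set d := √(a ^ 2 - 4 * b)
  have hd_pos : 0 < d := Real.sqrt_pos.2 (by linarith)
  have hd_sq : d ^ 2 = a ^ 2 - 4 * b := Real.sq_sqrt (by linarith)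
  have hda : d < a := by nlinarith
  have hx : √((a + d) / 2) ^ 2 = (a + d) / 2 := Real.sq_sqrt (by linarith)
  have hy : √((a - d) / 2) ^ 2 = (a - d) / 2 := Real.sq_sqrt (by linarith)
  refine ⟨√((a + d) / 2), √((a - d) / 2), Real.sqrt_lt_sqrt (by linarith) (by linarith),
    Real.sqrt_pos.2 (by linarith), ?_⟩
  generalize √((a + d) / 2) = x at *
  generalize √((a - d) / 2) = y at *
  have hsum : a = x ^ 2 + y ^ 2 := by linarith
  have hprod : b = x ^ 2 * y ^ 2 := by rw [hx, hy]; linarith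
  have hfactor : (X ^ 4 - C a * X ^ 2 + C b : ℝ[X]) =
      (({x, -x, y, -y} : Multiset ℝ).map fun z => X - C z).prod := by
    rw [hsum, hprod]
    simp
    ring
  rw [hfactor, roots_multiset_prod_X_sub_C]

theorem double_pendulum_saddle_saddle_equilibrium
    (α β : ℝ) (hα : 0 < α) (hβ : α ^ 2 < β)
    (γ : ℝ) (hγ : γ = β - α ^ 2)
    (J4 : Matrix (Fin 4) (Fin 4) ℝ)
    (hJ4 : J4 = (1 / γ) •
      !![0, 0, 1, -α;
         0, 0, -α, β;
         β * γ / α, 0, 0, 0;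
         0, γ, 0, 0]) :
    J4.charpoly = X ^ 4 - C (β * (1 + α) / (α * γ)) * X ^ 2 + C (β / (α * γ)) ∧
    ∃ lam1 lam2 : ℝ, lam1 > lam2 ∧ lam2 > 0 ∧
      J4.charpoly.roots = {lam1, -lam1, lam2, -lam2} := by
  have hγ_pos : 0 < γ := by linarith
  have hβ_pos : 0 < β := lt_trans (by positivity) hβ
  have hJ : J4 = !![0, 0, 1 / γ, -α / γ; 0, 0, -α / γ, β / γ; β / α, 0, 0, 0; 0, 1, 0, 0] := by
    rw [hJ4]
    ext i j
    fin_cases i <;> fin_cases j <;> simp <;> field_simp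
  have hchar : J4.charpoly =
      X ^ 4 - C (β * (1 + α) / (α * γ)) * X ^ 2 + C (β / (α * γ)) := by
    have htrace : 1 / γ * (β / α) + β / γ * 1 = β * (1 + α) / (α * γ) := by
      field_simp
    have hdet : (1 / γ * (β / γ) - (-α / γ) ^ 2) * (β / α * 1) = β / (α * γ) := by
      field_simp
      linarith
    rw [hJ, charpoly_offDiagonal_blocks, htrace, hdet]
  refine ⟨hchar, ?_⟩
  rw [hchar]
  refine biquadratic_roots (by positivity) (by positivity) ?_
  have hdisc : (β * (1 + α) / (α * γ)) ^ 2 - 4 * (β / (α * γ)) =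
      β * (β * (1 - α) ^ 2 + 4 * α ^ 3) / (α * γ) ^ 2 := by
    field_simp
    rw [hγ]
    ring
  have hdisc_pos : 0 < β * (β * (1 - α) ^ 2 + 4 * α ^ 3) / (α * γ) ^ 2 := by positivity
  linarith
end

section
/- Let α, β be real numbers with 0 < α and α² < β. Suppose θ1, θ2, p1, p2 : ℝ → ℝ are differentiable functions satisfying Hamilton's equations of the dimensionless double pendulum: (θ1′, θ2′) = B(cos Δθ)⁻¹·(p1, p2) and (p1′, p2′) = ((sin Δθ)/2)·((p1, p2)ᵀ·C(cos Δθ)·(p1, p2))·(1, −1) − ((β/α)·sin θ1, sin θ2), where Δθ = θ1 − θ2. Then the total energy H(θ1(τ), θ2(τ), p1(τ), p2(τ)) is constant in τ. -/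
open Matrix

/-- The dimensionless potential energy of the double pendulum. -/
noncomputable def dpV (α β θ1 θ2 : ℝ) : ℝ := -(β / α) * Real.cos θ1 - Real.cos θ2

/-- The dimensionless kinetic energy of the double pendulum. -/
noncomputable def dpT (α β θ1 θ2 p1 p2 : ℝ) : ℝ :=
  (1 / 2) * (![p1, p2] ⬝ᵥ (dpB α β (Real.cos (θ1 - θ2)))⁻¹.mulVec ![p1, p2])

/-- The dimensionless Hamiltonian of the double pendulum. -/
noncomputable def dpH (α β θ1 θ2 p1 p2 : ℝ) : ℝ :=
  dpT α β θ1 θ2 p1 p2 + dpV α β θ1 θ2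

theorem dpB_inv (α β x : ℝ) :
    (dpB α β x)⁻¹ = (β - α ^ 2 * x ^ 2)⁻¹ • !![1, -(α * x); -(α * x), β] := by
  rw [dpB, Matrix.inv_def, Matrix.det_fin_two_of, Matrix.adjugate_fin_two_of,
    Ring.inverse_eq_inv']
  congr 2
  ring

theorem dpB_inv_mulVec {α β x : ℝ} (h : β - α ^ 2 * x ^ 2 ≠ 0) (p q : ℝ) :
    (dpB α β x)⁻¹.mulVec ![p, q] =
      ![(p - α * x * q) / (β - α ^ 2 * x ^ 2), (β * q - α * x * p) / (β - α ^ 2 * x ^ 2)] := by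
  rw [dpB_inv]
  ext i
  fin_cases i <;> simp [Matrix.mulVec, dotProduct, Fin.sum_univ_two] <;> field_simp <;> ring

theorem dotProduct_dpC_mulVec (α β x p q : ℝ) :
    ![p, q] ⬝ᵥ (dpC α β x).mulVec ![p, q] =
      -(α / (β - α ^ 2 * x ^ 2) ^ 2) *
        (-(2 * α * x) * p ^ 2 + 2 * (β + α ^ 2 * x ^ 2) * p * q - 2 * α * β * x * q ^ 2) := by
  simp [dpC, Matrix.mulVec, dotProduct, Fin.sum_univ_two]
  ring

theorem dpT_eq {α β θ1 θ2 : ℝ} (h : β - α ^ 2 * Real.cos (θ1 - θ2) ^ 2 ≠ 0) (p q : ℝ) :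
    dpT α β θ1 θ2 p q =
      (p ^ 2 - 2 * α * Real.cos (θ1 - θ2) * p * q + β * q ^ 2) /
        (2 * (β - α ^ 2 * Real.cos (θ1 - θ2) ^ 2)) := by
  rw [dpT, dpB_inv_mulVec h]
  simp [dotProduct, Fin.sum_univ_two]
  field_simp
  ring

theorem sub_sq_mul_cos_sq_pos {α β : ℝ} (hβ : α ^ 2 < β) (t : ℝ) :
    0 < β - α ^ 2 * Real.cos t ^ 2 := by
  nlinarith [mul_le_mul_of_nonneg_left (Real.cos_sq_le_one t) (sq_nonneg α)]

theorem double_pendulum_energy_conservation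
    (α β : ℝ) (hα : 0 < α) (hβ : α ^ 2 < β)
    (θ1 θ2 p1 p2 : ℝ → ℝ)
    (hθ1 : ∀ τ : ℝ, HasDerivAt θ1
      ((dpB α β (Real.cos (θ1 τ - θ2 τ)))⁻¹.mulVec ![p1 τ, p2 τ] 0) τ)
    (hθ2 : ∀ τ : ℝ, HasDerivAt θ2
      ((dpB α β (Real.cos (θ1 τ - θ2 τ)))⁻¹.mulVec ![p1 τ, p2 τ] 1) τ)
    (hp1 : ∀ τ : ℝ, HasDerivAt p1
      (Real.sin (θ1 τ - θ2 τ) / 2 *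
        (![p1 τ, p2 τ] ⬝ᵥ (dpC α β (Real.cos (θ1 τ - θ2 τ))).mulVec ![p1 τ, p2 τ]) * 1
        - β / α * Real.sin (θ1 τ)) τ)
    (hp2 : ∀ τ : ℝ, HasDerivAt p2
      (Real.sin (θ1 τ - θ2 τ) / 2 *
        (![p1 τ, p2 τ] ⬝ᵥ (dpC α β (Real.cos (θ1 τ - θ2 τ))).mulVec ![p1 τ, p2 τ]) * (-1)
        - Real.sin (θ2 τ)) τ) :
    ∀ τ1 τ2 : ℝ,
      dpH α β (θ1 τ1) (θ2 τ1) (p1 τ1) (p2 τ1) =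
        dpH α β (θ1 τ2) (θ2 τ2) (p1 τ2) (p2 τ2) := by
  have hD (t : ℝ) : β - α ^ 2 * Real.cos t ^ 2 ≠ 0 := (sub_sq_mul_cos_sq_pos hβ t).ne'
  simp only [dpB_inv_mulVec (hD _), dotProduct_dpC_mulVec, Matrix.cons_val_zero,
    Matrix.cons_val_one] at hθ1 hθ2 hp1 hp2
  have key (τ : ℝ) :
      HasDerivAt (fun τ => dpH α β (θ1 τ) (θ2 τ) (p1 τ) (p2 τ)) 0 τ := by
    simp only [dpH, dpT_eq (hD _), dpV]
    have hx := ((hθ1 τ).sub (hθ2 τ)).cos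
    have hnum := (((hp1 τ).pow 2).sub
      (((hx.const_mul (2 * α)).mul (hp1 τ)).mul (hp2 τ))).add (((hp2 τ).pow 2).const_mul β)
    have hden := (((hx.pow 2).const_mul (α ^ 2)).const_sub β).const_mul 2
    have hV := ((hθ1 τ).cos.const_mul (-(β / α))).sub (hθ2 τ).cos
    have hE := (hnum.div hden (mul_ne_zero two_ne_zero (hD (θ1 τ - θ2 τ)))).add hV
    refine hE.congr_deriv ?_
    have hd := hD (θ1 τ - θ2 τ)
    simp only [Pi.sub_apply, Pi.add_apply, Pi.mul_apply, Pi.pow_apply]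
    generalize Real.cos (θ1 τ - θ2 τ) = x at *
    field_simp
    ring
  exact is_const_of_deriv_eq_zero (fun τ => (key τ).differentiableAt) fun τ => (key τ).deriv
end
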